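/- Let d ≥ 1, 1 < p < ∞, δ ∈ ℝ, and let m ≥ 0 be an integer. Assume either mp < d and p ≤ q ≤ dp/(d−mp), or mp = d and p ≤ q < ∞. Then there exists a constant C = C(d,m,p,q,δ) such that for every f ∈ C_c^∞(ℝ^d), (∫_{ℝ^d} (⟨x⟩^{δ−d/q} |f(x)|)^q dx)^{1/q} ≤ C · Σ_{|α|≤m} (∫_{ℝ^d} (⟨x⟩^{δ−d/p+|α|} |D^α f(x)|)^p dx)^{1/p}. -/

import Mathlib

open MeasureTheory Filter
open scoped BigOperators ENNReal Topology

noncomputable section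

/-- The Japanese bracket `⟨x⟩ = (1+|x|²)^{1/2}`. -/
def jb {d : ℕ} (x : EuclideanSpace ℝ (Fin d)) : ℝ := Real.sqrt (1 + ‖x‖ ^ 2)

/-- The partial derivative in the `i`-th coordinate direction. -/
def pd {d : ℕ} {F : Type*} [NormedAddCommGroup F] [NormedSpace ℝ F] (i : Fin d)
    (f : EuclideanSpace ℝ (Fin d) → F) : EuclideanSpace ℝ (Fin d) → F :=
  fun x => fderiv ℝ f x (EuclideanSpace.single i 1)

/-- Iterated partial derivatives along a list of coordinate directions. -/
def pdList {d : ℕ} {F : Type*} [NormedAddCommGroup F] [NormedSpace ℝ F] :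
    List (Fin d) → (EuclideanSpace ℝ (Fin d) → F) → EuclideanSpace ℝ (Fin d) → F
  | [], f => f
  | i :: l, f => pd i (pdList l f)

/-- The partial derivative `D^α f` corresponding to a multi-index `α : Fin d → ℕ`. -/
def mD {d : ℕ} {F : Type*} [NormedAddCommGroup F] [NormedSpace ℝ F] (α : Fin d → ℕ)
    (f : EuclideanSpace ℝ (Fin d) → F) : EuclideanSpace ℝ (Fin d) → F :=
  pdList ((List.finRange d).flatMap fun i => List.replicate (α i) i) f

/-- The order `|α|` of a multi-index. -/
def msize {d : ℕ} (α : Fin d → ℕ) : ℕ := ∑ i, α i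

/-- The finset of all multi-indices on `ℝ^d` of order at most `m`. -/
def mIdx (d m : ℕ) : Finset (Fin d → ℕ) :=
  (Fintype.piFinset fun _ : Fin d => Finset.range (m + 1)).filter fun α => msize α ≤ m


section Bracket

variable {d : ℕ}

lemma jb_eq_rpow (x : EuclideanSpace ℝ (Fin d)) : jb x = (1 + ‖x‖ ^ 2) ^ (1 / 2 : ℝ) :=
  Real.sqrt_eq_rpow _

lemma jb_pos (x : EuclideanSpace ℝ (Fin d)) : 0 < jb x :=
  Real.sqrt_pos.2 (by positivity)

lemma norm_le_jb (x : EuclideanSpace ℝ (Fin d)) : ‖x‖ ≤ jb x :=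
  Real.le_sqrt_of_sq_le (by linarith)

lemma jb_rpow (x : EuclideanSpace ℝ (Fin d)) (a : ℝ) :
    jb x ^ a = (1 + ‖x‖ ^ 2) ^ (a / 2) := by
  rw [jb_eq_rpow, ← Real.rpow_mul (by positivity)]
  ring_nf

lemma contDiff_jb_rpow (a : ℝ) {n : WithTop ℕ∞} :
    ContDiff ℝ n fun x : EuclideanSpace ℝ (Fin d) => jb x ^ a := by
  simp_rw [jb_rpow]
  exact (contDiff_const.add (contDiff_norm_sq ℝ)).rpow_const_of_ne fun x => by positivity

lemma norm_fderiv_jb_rpow_le (a : ℝ) (x : EuclideanSpace ℝ (Fin d)) :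
    ‖fderiv ℝ (fun y : EuclideanSpace ℝ (Fin d) => jb y ^ a) x‖ ≤ |a| * jb x ^ (a - 1) := by
  have hpos : 0 < 1 + ‖x‖ ^ 2 := by positivity
  have h1 : HasFDerivAt (fun y : EuclideanSpace ℝ (Fin d) => 1 + ‖y‖ ^ 2)
      (2 • innerSL ℝ x) x := by
    simpa using ((hasFDerivAt_id x).norm_sq).const_add 1
  have h2 := h1.rpow_const (p := a / 2) (Or.inl hpos.ne')
  simp_rw [jb_rpow _ a]
  rw [h2.fderiv, norm_smul, ← Nat.cast_smul_eq_nsmul ℝ, norm_smul, innerSL_apply_norm]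
  have h3 : (1 + ‖x‖ ^ 2) ^ (a / 2 - 1) = jb x ^ (a - 2) := by
    rw [jb_rpow]
    ring_nf
  have h4 : jb x ^ (a - 1) = jb x ^ (a - 2) * jb x := by
    rw [← Real.rpow_add_one (jb_pos x).ne']
    ring_nf
  have h5 : 0 ≤ jb x ^ (a - 2) := Real.rpow_nonneg (jb_pos x).le _
  rw [h3, h4, Real.norm_eq_abs, abs_mul, abs_of_nonneg h5, abs_div]
  have h6 := mul_le_mul_of_nonneg_left (norm_le_jb x) (mul_nonneg (abs_nonneg a) h5)
  calc |a| / |2| * jb x ^ (a - 2) * (‖((2 : ℕ) : ℝ)‖ * ‖x‖)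
      = |a| * jb x ^ (a - 2) * ‖x‖ := by
        norm_num
        ring
    _ ≤ _ := by linarith

lemma norm_fderiv_jb_rpow_mul_le (a : ℝ) {h : EuclideanSpace ℝ (Fin d) → ℝ}
    (hh : Differentiable ℝ h) (x : EuclideanSpace ℝ (Fin d)) :
    ‖fderiv ℝ (fun y => jb y ^ a * h y) x‖ ≤
      |a| * (jb x ^ (a - 1) * |h x|) + jb x ^ a * ‖fderiv ℝ h x‖ := by
  have hj : DifferentiableAt ℝ (fun y : EuclideanSpace ℝ (Fin d) => jb y ^ a) x :=
    (contDiff_jb_rpow a (n := 1)).differentiable (by simp) x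
  rw [fderiv_fun_mul hj (hh x)]
  refine (norm_add_le _ _).trans ?_
  rw [norm_smul, norm_smul, Real.norm_eq_abs, Real.norm_eq_abs,
    abs_of_nonneg (Real.rpow_nonneg (jb_pos x).le a), add_comm]
  have := mul_le_mul_of_nonneg_left (norm_fderiv_jb_rpow_le a x) (abs_nonneg (h x))
  linarith

end Bracket

section PartialDerivatives

variable {d : ℕ}

lemma ContDiff.pd {f : EuclideanSpace ℝ (Fin d) → ℝ} (hf : ContDiff ℝ (⊤ : ℕ∞) f) (i : Fin d) :
    ContDiff ℝ (⊤ : ℕ∞) (pd i f) :=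
  (hf.fderiv_right (m := (⊤ : ℕ∞)) (by norm_cast)).clm_apply contDiff_const

lemma ContDiff.pdList {f : EuclideanSpace ℝ (Fin d) → ℝ} (hf : ContDiff ℝ (⊤ : ℕ∞) f) :
    ∀ l : List (Fin d), ContDiff ℝ (⊤ : ℕ∞) (pdList l f)
  | [] => hf
  | i :: l => (hf.pdList l).pd i

lemma HasCompactSupport.pd {f : EuclideanSpace ℝ (Fin d) → ℝ} (hf : HasCompactSupport f)
    (i : Fin d) : HasCompactSupport (pd i f) :=
  hf.fderiv_apply ℝ _

lemma HasCompactSupport.pdList {f : EuclideanSpace ℝ (Fin d) → ℝ} (hf : HasCompactSupport f) :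
    ∀ l : List (Fin d), HasCompactSupport (pdList l f)
  | [] => hf
  | i :: l => (hf.pdList l).pd i

lemma pd_comm {f : EuclideanSpace ℝ (Fin d) → ℝ} (hf : ContDiff ℝ (⊤ : ℕ∞) f) (i j : Fin d) :
    pd i (pd j f) = pd j (pd i f) := by
  have hdiff : Differentiable ℝ (fderiv ℝ f) :=
    (hf.fderiv_right (m := 1) (by norm_cast)).differentiable (by simp)
  have key : ∀ (a b : Fin d) x, pd a (pd b f) x =
      fderiv ℝ (fderiv ℝ f) x (EuclideanSpace.single a 1) (EuclideanSpace.single b 1) := by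
    intro a b x
    change fderiv ℝ (fun y => fderiv ℝ f y (EuclideanSpace.single b 1)) x _ = _
    rw [fderiv_clm_apply (hdiff x) (by fun_prop)]
    simp
  funext x
  rw [key, key]
  exact hf.contDiffAt.isSymmSndFDerivAt
    (by simpa using WithTop.coe_le_coe.2 (le_top : (2 : ℕ∞) ≤ ⊤)) _ _

lemma pdList_perm {f : EuclideanSpace ℝ (Fin d) → ℝ} (hf : ContDiff ℝ (⊤ : ℕ∞) f)
    {l l' : List (Fin d)} (h : l.Perm l') : pdList l f = pdList l' f := by
  induction h with
  | nil => rfl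
  | cons i _ ih => exact congrArg (pd i) ih
  | swap i j l => exact pd_comm (hf.pdList l) j i
  | trans _ _ ih₁ ih₂ => exact ih₁.trans ih₂

lemma pdList_eq_mD {f : EuclideanSpace ℝ (Fin d) → ℝ} (hf : ContDiff ℝ (⊤ : ℕ∞) f)
    (l : List (Fin d)) : pdList l f = mD (fun i => l.count i) f := by
  refine pdList_perm hf (List.perm_iff_count.2 fun i => ?_)
  rw [List.count_flatMap, ← Fin.sum_univ_def]
  simp [List.count_replicate]

lemma msize_count (l : List (Fin d)) : msize (fun i => l.count i) = l.length := by
  simpa [msize] using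
    Multiset.sum_count_eq_card (s := Finset.univ) (m := (l : Multiset (Fin d))) (by simp)

lemma count_mem_mIdx {m : ℕ} {l : List (Fin d)} (hl : l.length ≤ m) :
    (fun i => l.count i) ∈ mIdx d m := by
  rw [mIdx, Finset.mem_filter, Fintype.mem_piFinset, msize_count]
  exact ⟨fun i => Finset.mem_range_succ_iff.2 (List.count_le_length.trans hl), hl⟩

lemma norm_fderiv_le_sum_abs_pd (f : EuclideanSpace ℝ (Fin d) → ℝ) (x : EuclideanSpace ℝ (Fin d)) :
    ‖fderiv ℝ f x‖ ≤ ∑ i, |pd i f x| := by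
  refine ContinuousLinearMap.opNorm_le_bound _ (by positivity) fun v => ?_
  have hv : v = ∑ i, v i • EuclideanSpace.single i (1 : ℝ) := by
    simpa using ((EuclideanSpace.basisFun (Fin d) ℝ).sum_repr v).symm
  conv_lhs => rw [hv, map_sum]
  rw [Finset.sum_mul]
  refine (norm_sum_le _ _).trans (Finset.sum_le_sum fun i _ => ?_)
  rw [map_smul, norm_smul, mul_comm]
  exact mul_le_mul_of_nonneg_left (PiLp.norm_apply_le v i) (abs_nonneg _)

end PartialDerivatives

/-- The norm of `f` in the weighted Lebesgue space `L^s_{δ - d/s}(ℝ^d)`. -/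
def weightedNorm {d : ℕ} (s δ : ℝ) (f : EuclideanSpace ℝ (Fin d) → ℝ) : ℝ≥0∞ :=
  eLpNorm (fun x => jb x ^ (δ - d / s) * f x) (ENNReal.ofReal s) volume

section WeightedNorm

variable {d : ℕ}

lemma weightedNorm_eq_integral {s δ : ℝ} (hs : 0 < s) {f : EuclideanSpace ℝ (Fin d) → ℝ}
    (hf : Continuous f) (hfc : HasCompactSupport f) :
    weightedNorm s δ f =
      ENNReal.ofReal ((∫ x, (jb x ^ (δ - d / s) * |f x|) ^ s) ^ (1 / s)) := by
  have hcont : Continuous fun x : EuclideanSpace ℝ (Fin d) => jb x ^ (δ - d / s) * f x :=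
    (contDiff_jb_rpow _ (n := 0)).continuous.mul hf
  rw [weightedNorm, MemLp.eLpNorm_eq_integral_rpow_norm (by simpa using hs) ENNReal.ofReal_ne_top
    (hcont.memLp_of_hasCompactSupport hfc.mul_left), ENNReal.toReal_ofReal hs.le, one_div]
  simp_rw [norm_mul, Real.norm_eq_abs, fun x : EuclideanSpace ℝ (Fin d) =>
    abs_of_pos (Real.rpow_pos_of_pos (jb_pos x) (δ - d / s))]

lemma weightedNorm_rpow_eq_lintegral {s δ : ℝ} (hs : 0 < s) (f : EuclideanSpace ℝ (Fin d) → ℝ) :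
    weightedNorm s δ f ^ s =
      ∫⁻ x, ENNReal.ofReal (jb x ^ (-d : ℝ)) * ENNReal.ofReal (jb x ^ δ * |f x|) ^ s := by
  rw [weightedNorm, eLpNorm_eq_lintegral_rpow_enorm_toReal (by simpa using hs)
    ENNReal.ofReal_ne_top, ENNReal.toReal_ofReal hs.le, ← ENNReal.rpow_mul,
    one_div_mul_cancel hs.ne', ENNReal.rpow_one]
  refine lintegral_congr fun x => ?_
  have hj := jb_pos x
  rw [← ofReal_norm, norm_mul, Real.norm_eq_abs, Real.norm_eq_abs,
    abs_of_pos (Real.rpow_pos_of_pos hj _), ENNReal.ofReal_rpow_of_nonneg (by positivity) hs.le,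
    ENNReal.ofReal_rpow_of_nonneg (by positivity) hs.le, ← ENNReal.ofReal_mul (by positivity),
    Real.mul_rpow (by positivity) (by positivity), Real.mul_rpow (by positivity) (by positivity),
    ← mul_assoc, ← Real.rpow_mul hj.le, ← Real.rpow_mul hj.le, ← Real.rpow_add hj]
  congr 4
  field_simp
  ring

lemma ENNReal.rpow_le_rpow_add_rpow (t : ℝ≥0∞) {p q r : ℝ} (hpq : p ≤ q) (hqr : q ≤ r) :
    t ^ q ≤ t ^ p + t ^ r := by
  rcases le_total t 1 with ht | ht
  · exact (ENNReal.rpow_le_rpow_of_exponent_ge ht hpq).trans le_self_add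
  · exact (ENNReal.rpow_le_rpow_of_exponent_le ht hqr).trans le_add_self

lemma weightedNorm_interpolation {p q r δ : ℝ} (hp : 0 < p) (hpq : p ≤ q) (hqr : q ≤ r)
    {f : EuclideanSpace ℝ (Fin d) → ℝ} (hf : Continuous f) {K : ℝ} (hK : 0 < K)
    (hfp : weightedNorm p δ f ≤ ENNReal.ofReal K) (hfr : weightedNorm r δ f ≤ ENNReal.ofReal K) :
    weightedNorm q δ f ≤ ENNReal.ofReal (2 ^ (1 / q) * K) := by
  have hq := hp.trans_le hpq
  have hr := hq.trans_le hqr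
  set g : EuclideanSpace ℝ (Fin d) → ℝ := fun x => K⁻¹ * f x with hg
  have hgcont : Continuous g := continuous_const.mul hf
  have hscale : ∀ s, weightedNorm s δ g = (ENNReal.ofReal K)⁻¹ * weightedNorm s δ f := by
    intro s
    have : (fun x => jb x ^ (δ - d / s) * g x) = K⁻¹ • fun x => jb x ^ (δ - d / s) * f x := by
      funext x
      simp [hg]
      ring
    rw [weightedNorm, this, eLpNorm_const_smul, weightedNorm, ← ofReal_norm,
      Real.norm_of_nonneg (inv_nonneg.2 hK.le), ENNReal.ofReal_inv_of_pos hK]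
  have hK0 : ENNReal.ofReal K ≠ 0 := by simpa using hK
  have hone : ∀ s, 0 < s → weightedNorm s δ f ≤ ENNReal.ofReal K → weightedNorm s δ g ^ s ≤ 1 := by
    intro s hs h
    refine ENNReal.rpow_le_one ?_ hs.le
    rw [hscale]
    exact (mul_le_mul_right h _).trans (ENNReal.inv_mul_cancel hK0 ENNReal.ofReal_ne_top).le
  have hmeas : ∀ s : ℝ, Measurable fun x =>
      ENNReal.ofReal (jb x ^ (-d : ℝ)) * ENNReal.ofReal (jb x ^ δ * |g x|) ^ s := fun s =>
    ((contDiff_jb_rpow _ (n := 0)).continuous.measurable.ennreal_ofReal).mul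
      (((contDiff_jb_rpow _ (n := 0)).continuous.mul
        hgcont.abs).measurable.ennreal_ofReal.pow_const s)
  have htwo : weightedNorm q δ g ^ q ≤ 2 := by
    calc weightedNorm q δ g ^ q
        ≤ weightedNorm p δ g ^ p + weightedNorm r δ g ^ r := by
          rw [weightedNorm_rpow_eq_lintegral hp, weightedNorm_rpow_eq_lintegral hq,
            weightedNorm_rpow_eq_lintegral hr, ← lintegral_add_left (hmeas p)]
          refine lintegral_mono fun x => ?_
          rw [← mul_add]
          gcongr
          exact ENNReal.rpow_le_rpow_add_rpow _ hpq hqr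
      _ ≤ 1 + 1 := add_le_add (hone p hp hfp) (hone r hr hfr)
      _ = 2 := one_add_one_eq_two
  have h2 : weightedNorm q δ g ≤ 2 ^ (1 / q) := by
    rw [one_div]
    exact (ENNReal.le_rpow_inv_iff hq).2 htwo
  rw [hscale, ← ENNReal.div_eq_inv_mul] at h2
  rw [ENNReal.ofReal_mul (by positivity), ← ENNReal.ofReal_rpow_of_pos two_pos,
    ENNReal.ofReal_ofNat]
  exact (ENNReal.div_le_iff hK0 ENNReal.ofReal_ne_top).1 h2

/-- The weighted first-order Sobolev norm of `f` in `W^{1,s}_{δ - d/s}(ℝ^d)`. -/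
def weightedSobolevNormOne (s δ : ℝ) (f : EuclideanSpace ℝ (Fin d) → ℝ) : ℝ≥0∞ :=
  weightedNorm s δ f + ∑ i, weightedNorm s (δ + 1) (pd i f)

lemma eLpNorm_add_fderiv_le {s δ : ℝ} (hs : 1 ≤ s) (c : ℝ) {f : EuclideanSpace ℝ (Fin d) → ℝ}
    (hf : ContDiff ℝ (⊤ : ℕ∞) f) :
    eLpNorm (fun x => c * (jb x ^ (δ - d / s) * |f x|) + jb x ^ (δ + 1 - d / s) * ‖fderiv ℝ f x‖)
      (ENNReal.ofReal s) volume ≤ (1 + ‖c‖ₑ) * weightedSobolevNormOne s δ f := by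
  have hw : ∀ a : ℝ, Continuous fun x : EuclideanSpace ℝ (Fin d) => jb x ^ a := fun a =>
    (contDiff_jb_rpow a (n := 0)).continuous
  have hs' : 1 ≤ ENNReal.ofReal s := by simpa using hs
  have hder : eLpNorm (fun x => jb x ^ (δ + 1 - d / s) * ‖fderiv ℝ f x‖)
      (ENNReal.ofReal s) volume ≤ ∑ i, weightedNorm s (δ + 1) (pd i f) := by
    calc eLpNorm (fun x => jb x ^ (δ + 1 - d / s) * ‖fderiv ℝ f x‖) (ENNReal.ofReal s) volume
        ≤ eLpNorm (∑ i, fun x => ‖jb x ^ (δ + 1 - d / s) * pd i f x‖)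
            (ENNReal.ofReal s) volume := by
          refine eLpNorm_mono_real fun x => ?_
          have hj : 0 < jb x ^ (δ + 1 - d / s) := Real.rpow_pos_of_pos (jb_pos x) _
          rw [Finset.sum_apply, norm_mul, norm_norm, Real.norm_of_nonneg hj.le]
          simp_rw [norm_mul, Real.norm_of_nonneg hj.le]
          rw [← Finset.mul_sum]
          gcongr
          exact norm_fderiv_le_sum_abs_pd f x
      _ ≤ ∑ i, eLpNorm (fun x => ‖jb x ^ (δ + 1 - d / s) * pd i f x‖)
            (ENNReal.ofReal s) volume :=
          eLpNorm_sum_le (fun i _ =>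
            ((hw _).mul (hf.pd i).continuous).norm.aestronglyMeasurable) hs'
      _ = _ := by simp only [eLpNorm_norm, weightedNorm]
  have hzero : eLpNorm (fun x => c * (jb x ^ (δ - d / s) * |f x|)) (ENNReal.ofReal s) volume
      = ‖c‖ₑ * weightedNorm s δ f := by
    rw [weightedNorm, ← eLpNorm_const_smul]
    refine eLpNorm_congr_norm_ae (ae_of_all _ fun x => ?_)
    simp
  calc _ ≤ eLpNorm (fun x => c * (jb x ^ (δ - d / s) * |f x|)) (ENNReal.ofReal s) volume +
        eLpNorm (fun x => jb x ^ (δ + 1 - d / s) * ‖fderiv ℝ f x‖) (ENNReal.ofReal s) volume :=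
        eLpNorm_add_le
          (continuous_const.mul ((hw _).mul hf.continuous.abs)).aestronglyMeasurable
          ((hw _).mul (hf.continuous_fderiv (by simp)).norm).aestronglyMeasurable hs'
    _ ≤ ‖c‖ₑ * weightedNorm s δ f + ∑ i, weightedNorm s (δ + 1) (pd i f) := by
        rw [hzero]
        gcongr
    _ ≤ _ := by
        rw [weightedSobolevNormOne, mul_add]
        gcongr
        · exact le_add_self
        · exact le_mul_of_one_le_left zero_le le_self_add

lemma weightedNorm_le_weightedSobolevNormOne (hd : 1 ≤ d) {s s' δ : ℝ} (hs : 1 ≤ s)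
    (hs'0 : 0 < s') (hs' : s'⁻¹ = s⁻¹ - (d : ℝ)⁻¹) :
    ∃ C : ℝ≥0∞, C ≠ ∞ ∧ ∀ f : EuclideanSpace ℝ (Fin d) → ℝ, ContDiff ℝ (⊤ : ℕ∞) f →
      HasCompactSupport f → weightedNorm s' δ f ≤ C * weightedSobolevNormOne s δ f := by
  have hs0 : 0 < s := one_pos.trans_le hs
  set a : ℝ := δ - d / s' with ha
  refine ⟨eLpNormLESNormFDerivOfEqInnerConst (volume : Measure (EuclideanSpace ℝ (Fin d)))
    (s.toNNReal : ℝ) * (1 + ‖|a|‖ₑ), by finiteness, fun f hf hfc => ?_⟩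
  have hd' : (d : ℝ) ≠ 0 := by positivity
  have has : a = δ + 1 - d / s := by
    rw [ha, div_eq_mul_inv, hs']
    field_simp
    ring
  have hsob := eLpNorm_le_eLpNorm_fderiv_of_eq_inner
    (volume : Measure (EuclideanSpace ℝ (Fin d))) (u := fun x => jb x ^ a * f x)
    ((contDiff_jb_rpow a).mul (hf.of_le (by exact_mod_cast le_top))) hfc.mul_left
    (p := s.toNNReal) (p' := s'.toNNReal) (by simpa using hs)
    (by simpa using Nat.pos_of_ne_zero (by omega))
    (by simpa [hs0.le, hs'0.le] using hs')
  refine hsob.trans ?_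
  rw [mul_assoc]
  gcongr
  refine (eLpNorm_mono_real fun x => ?_).trans (eLpNorm_add_fderiv_le hs |a| hf)
  refine (norm_fderiv_jb_rpow_mul_le a (hf.differentiable (by simp)) x).trans (le_of_eq ?_)
  rw [← has, show a - 1 = δ - d / s by rw [has]; ring]

lemma weightedNorm_pow_eq {r δ : ℝ} (hr : 0 < r) {n : ℕ} (hn : n ≠ 0)
    (f : EuclideanSpace ℝ (Fin d) → ℝ) :
    weightedNorm (r * n) δ f ^ n =
      eLpNorm (fun x => jb x ^ (n * δ - d / r) * f x ^ n) (ENNReal.ofReal r) volume := by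
  have hn' : (0 : ℝ) < n := by positivity
  rw [weightedNorm, ENNReal.ofReal_mul hr.le, ← ENNReal.rpow_natCast, ← eLpNorm_norm_rpow _ hn']
  refine eLpNorm_congr_norm_ae (ae_of_all _ fun x => ?_)
  have hj := jb_pos x
  rw [Real.rpow_natCast, norm_pow, norm_norm, ← norm_pow, mul_pow, ← Real.rpow_mul_natCast hj.le]
  congr 3
  field_simp

lemma eLpNorm_jb_rpow_mul_pow_succ_le (hd : 2 ≤ d) {r : ℝ} (hr : Real.HolderConjugate d r)
    (δ : ℝ) (n : ℕ) :
    ∃ C : ℝ≥0∞, C ≠ ∞ ∧ ∀ f : EuclideanSpace ℝ (Fin d) → ℝ, ContDiff ℝ (⊤ : ℕ∞) f →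
      HasCompactSupport f →
      eLpNorm (fun x => jb x ^ ((n + 1 : ℕ) * δ - d / r) * f x ^ (n + 1))
          (ENNReal.ofReal r) volume ≤
        C * eLpNorm (fun x => jb x ^ (n * δ - d / r) * f x ^ n) (ENNReal.ofReal r) volume *
          weightedSobolevNormOne d δ f := by
  have hd0 : (d : ℝ) ≠ 0 := by positivity
  have hd1 : (1 : ℝ) ≤ d := by exact_mod_cast (by omega : 1 ≤ d)
  set b : ℝ := (n + 1 : ℕ) * δ - d / r with hb
  refine ⟨eLpNormLESNormFDerivOneConst (volume : Measure (EuclideanSpace ℝ (Fin d)))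
    (r.toNNReal : ℝ) * (‖(n + 1 : ℝ)‖ₑ * (1 + ‖|b|‖ₑ)), by finiteness, fun f hf hfc => ?_⟩
  have hw : ∀ a : ℝ, Continuous fun x : EuclideanSpace ℝ (Fin d) => jb x ^ a := fun a =>
    (contDiff_jb_rpow a (n := 0)).continuous
  have hf1 : ContDiff ℝ 1 f := hf.of_le (by exact_mod_cast le_top)
  have hsob := eLpNorm_le_eLpNorm_fderiv_one
    (volume : Measure (EuclideanSpace ℝ (Fin d))) (u := fun x => jb x ^ b * f x ^ (n + 1))
    ((contDiff_jb_rpow b).mul (hf1.pow _))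
    ((hfc.comp_left (g := fun t => t ^ (n + 1)) (by simp)).mul_left)
    (p := r.toNNReal) (by
      rw [← NNReal.holderConjugate_coe_iff]
      simpa [hr.symm.nonneg] using hr)
  refine hsob.trans ?_
  set φ : EuclideanSpace ℝ (Fin d) → ℝ := fun x => jb x ^ (n * δ - d / r) * f x ^ n with hφ
  set Φ : EuclideanSpace ℝ (Fin d) → ℝ := fun x =>
    |b| * (jb x ^ (δ - d / d) * |f x|) + jb x ^ (δ + 1 - d / d) * ‖fderiv ℝ f x‖ with hΦ
  have hpoint : ∀ x, ‖fderiv ℝ (fun x => jb x ^ b * f x ^ (n + 1)) x‖ ≤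
      ‖(φ • ((n + 1 : ℝ) • Φ)) x‖ := by
    intro x
    have hj := jb_pos x
    refine (norm_fderiv_jb_rpow_mul_le b ((hf1.pow _).differentiable (by simp)) x).trans ?_
    have hΦ0 : 0 ≤ Φ x := by positivity
    have hpow : ‖fderiv ℝ (fun y => f y ^ (n + 1)) x‖ = (n + 1) * |f x| ^ n * ‖fderiv ℝ f x‖ := by
      rw [fderiv_fun_pow _ (hf1.differentiable (by simp) x), norm_smul]
      simp [abs_of_nonneg (by positivity : (0 : ℝ) ≤ n + 1)]
    have hb1 : jb x ^ (b - 1) = jb x ^ (n * δ - d / r) * jb x ^ (δ - d / d) := by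
      rw [← Real.rpow_add hj, hb, div_self hd0]
      push_cast
      ring_nf
    have hb2 : jb x ^ b = jb x ^ (n * δ - d / r) * jb x ^ (δ + 1 - d / d) := by
      rw [← Real.rpow_add hj, hb, div_self hd0]
      push_cast
      ring_nf
    rw [hpow, hb1, hb2, Pi.smul_apply', Pi.smul_apply, smul_eq_mul, smul_eq_mul, norm_mul,
      norm_mul (_ + _), Real.norm_of_nonneg hΦ0,
      Real.norm_of_nonneg (by positivity : (0 : ℝ) ≤ n + 1), hφ, norm_mul,
      Real.norm_of_nonneg (Real.rpow_nonneg hj.le _), norm_pow, Real.norm_eq_abs, hΦ, abs_pow,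
      pow_succ]
    have hnn : 0 ≤ (n : ℝ) * (jb x ^ (n * δ - d / r) * |f x| ^ n *
      (|b| * (jb x ^ (δ - d / d) * |f x|))) := by positivity
    linarith
  have := hr.symm.ennrealOfReal
  have hφm : AEStronglyMeasurable φ volume :=
    ((hw _).mul (hf.continuous.pow n)).aestronglyMeasurable
  have hΦm : AEStronglyMeasurable ((n + 1 : ℝ) • Φ) volume := by
    refine Continuous.aestronglyMeasurable (continuous_const.smul ?_)
    exact (continuous_const.mul ((hw _).mul hf.continuous.abs)).add
      ((hw _).mul (hf.continuous_fderiv (by simp)).norm)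
  calc _ ≤ eLpNormLESNormFDerivOneConst (volume : Measure (EuclideanSpace ℝ (Fin d)))
        (r.toNNReal : ℝ) * (eLpNorm φ (ENNReal.ofReal r) volume *
          eLpNorm ((n + 1 : ℝ) • Φ) (ENNReal.ofReal d) volume) := by
        gcongr
        exact (eLpNorm_mono hpoint).trans (eLpNorm_smul_le_mul_eLpNorm hΦm hφm)
    _ ≤ eLpNormLESNormFDerivOneConst (volume : Measure (EuclideanSpace ℝ (Fin d)))
        (r.toNNReal : ℝ) * (eLpNorm φ (ENNReal.ofReal r) volume *
          (‖(n + 1 : ℝ)‖ₑ * ((1 + ‖|b|‖ₑ) * weightedSobolevNormOne d δ f))) := by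
        rw [eLpNorm_const_smul]
        gcongr
        exact eLpNorm_add_fderiv_le hd1 |b| hf
    _ = _ := by ring

lemma exists_weightedNorm_le_weightedSobolevNormOne_dim (hd : 2 ≤ d) (q δ : ℝ) :
    ∃ s, q ≤ s ∧ ∃ C : ℝ≥0∞, C ≠ ∞ ∧ ∀ f : EuclideanSpace ℝ (Fin d) → ℝ,
      ContDiff ℝ (⊤ : ℕ∞) f → HasCompactSupport f →
      weightedNorm s δ f ≤ C * weightedSobolevNormOne d δ f := by
  have hd1 : (1 : ℝ) < d := by exact_mod_cast hd
  have hr := Real.HolderConjugate.conjExponent hd1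
  set r := Real.conjExponent d
  have hpow : ∀ k : ℕ, ∃ C : ℝ≥0∞, C ≠ ∞ ∧ ∀ f : EuclideanSpace ℝ (Fin d) → ℝ,
      ContDiff ℝ (⊤ : ℕ∞) f → HasCompactSupport f →
      weightedNorm (r * (d - 1 + k : ℕ)) δ f ^ (d - 1 + k) ≤
        C * weightedSobolevNormOne d δ f ^ (d - 1 + k) := by
    intro k
    induction k with
    | zero =>
      refine ⟨1, by simp, fun f _ _ => ?_⟩
      have : r * (d - 1 + 0 : ℕ) = d := by
        rw [add_zero, Nat.cast_sub (by omega), Nat.cast_one, mul_comm, hr.sub_one_mul_conj]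
      rw [this, one_mul]
      gcongr
      exact le_self_add
    | succ k ih =>
      obtain ⟨C, hC, hbound⟩ := ih
      obtain ⟨C', hC', hstep⟩ := eLpNorm_jb_rpow_mul_pow_succ_le hd hr δ (d - 1 + k)
      refine ⟨C' * C, by finiteness, fun f hf hfc => ?_⟩
      have hb := hbound f hf hfc
      rw [weightedNorm_pow_eq hr.symm.pos (by omega)] at hb
      rw [← add_assoc, weightedNorm_pow_eq hr.symm.pos (by omega)]
      refine (hstep f hf hfc).trans ?_
      rw [pow_succ, ← mul_assoc, mul_assoc C' C]
      gcongr
  obtain ⟨C, hC, hbound⟩ := hpow ⌈q⌉₊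
  set n := d - 1 + ⌈q⌉₊
  have hn0 : n ≠ 0 := by omega
  refine ⟨r * n, ?_, C ^ (1 / n : ℝ), by finiteness, fun f hf hfc => ?_⟩
  · calc q ≤ ⌈q⌉₊ := Nat.le_ceil q
      _ ≤ n := by exact_mod_cast Nat.le_add_left _ _
      _ ≤ r * n := le_mul_of_one_le_left (by positivity) hr.symm.lt.le
  · have hn' : (0 : ℝ) < n := by positivity
    have h := ENNReal.rpow_le_rpow (hbound f hf hfc) (one_div_nonneg.2 hn'.le)
    rwa [ENNReal.mul_rpow_of_nonneg _ _ (one_div_nonneg.2 hn'.le), one_div,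
      ENNReal.pow_rpow_inv_natCast hn0, ENNReal.pow_rpow_inv_natCast hn0, ← one_div] at h

/-- The weighted Sobolev norm of `f` in `W^{m,p}_{δ - d/p}(ℝ^d)`. -/
def weightedSobolevNorm (m : ℕ) (p δ : ℝ) (f : EuclideanSpace ℝ (Fin d) → ℝ) : ℝ≥0∞ :=
  ∑ α ∈ mIdx d m, weightedNorm p (δ + msize α) (mD α f)

lemma weightedNorm_pdList_le_weightedSobolevNorm {m : ℕ} (p δ : ℝ)
    {f : EuclideanSpace ℝ (Fin d) → ℝ} (hf : ContDiff ℝ (⊤ : ℕ∞) f) {l : List (Fin d)}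
    (hl : l.length ≤ m) :
    weightedNorm p (δ + l.length) (pdList l f) ≤ weightedSobolevNorm m p δ f := by
  rw [pdList_eq_mD hf, ← msize_count]
  exact Finset.single_le_sum
    (f := fun α : Fin d → ℕ => weightedNorm p (δ + msize α) (mD α f)) (fun _ _ => zero_le)
    (count_mem_mIdx hl)

lemma weightedSobolevNormOne_pdList_le {m : ℕ} {p s δ : ℝ} {k : ℕ} {C₀ C₁ : ℝ≥0∞}
    (h₀ : ∀ f : EuclideanSpace ℝ (Fin d) → ℝ, ContDiff ℝ (⊤ : ℕ∞) f → HasCompactSupport f →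
      ∀ l : List (Fin d), l.length = k →
        weightedNorm s (δ + k) (pdList l f) ≤ C₀ * weightedSobolevNorm m p δ f)
    (h₁ : ∀ f : EuclideanSpace ℝ (Fin d) → ℝ, ContDiff ℝ (⊤ : ℕ∞) f → HasCompactSupport f →
      ∀ l : List (Fin d), l.length = k + 1 →
        weightedNorm s (δ + (k + 1 : ℕ)) (pdList l f) ≤ C₁ * weightedSobolevNorm m p δ f)
    {f : EuclideanSpace ℝ (Fin d) → ℝ} (hf : ContDiff ℝ (⊤ : ℕ∞) f) (hfc : HasCompactSupport f)
    {l : List (Fin d)} (hl : l.length = k) :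
    weightedSobolevNormOne s (δ + k) (pdList l f) ≤
      (C₀ + d * C₁) * weightedSobolevNorm m p δ f := by
  rw [weightedSobolevNormOne, add_mul]
  refine add_le_add (h₀ f hf hfc l hl) ?_
  calc ∑ i, weightedNorm s (δ + k + 1) (pd i (pdList l f))
      ≤ ∑ _i : Fin d, C₁ * weightedSobolevNorm m p δ f := by
        refine Finset.sum_le_sum fun i _ => ?_
        have := h₁ f hf hfc (i :: l) (by simp [hl])
        rwa [Nat.cast_succ, ← add_assoc] at this
    _ = _ := by simp [mul_assoc]

lemma weightedNorm_pdList_le {m : ℕ} (hd : 1 ≤ d) {p : ℝ} (hp : 1 < p) (δ : ℝ) (j : ℕ)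
    (hj : j * p < d) (k : ℕ) (hk : k + j ≤ m) :
    ∃ C : ℝ≥0∞, C ≠ ∞ ∧ ∀ f : EuclideanSpace ℝ (Fin d) → ℝ, ContDiff ℝ (⊤ : ℕ∞) f →
      HasCompactSupport f → ∀ l : List (Fin d), l.length = k →
        weightedNorm (p⁻¹ - j / d)⁻¹ (δ + k) (pdList l f) ≤ C * weightedSobolevNorm m p δ f := by
  have hp0 : 0 < p := one_pos.trans hp
  have hd0 : (0 : ℝ) < d := by positivity
  induction j generalizing k with
  | zero =>
    refine ⟨1, by simp, fun f hf _ l hl => ?_⟩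
    subst hl
    simpa using weightedNorm_pdList_le_weightedSobolevNorm p δ hf (l := l) (by omega)
  | succ j ih =>
    have hj' : j * p < d := by
      push_cast at hj
      linarith
    obtain ⟨C₀, hC₀, h₀⟩ := ih hj' k (by omega)
    obtain ⟨C₁, hC₁, h₁⟩ := ih hj' (k + 1) (by omega)
    have hpos : ∀ i : ℕ, i * p < d → 0 < p⁻¹ - i / d := by
      intro i hi
      rw [sub_pos, div_lt_iff₀ hd0, inv_mul_eq_div, lt_div_iff₀ hp0]
      exact hi
    have hone : 1 ≤ (p⁻¹ - j / d)⁻¹ := by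
      refine (one_le_inv₀ (hpos j hj')).2 ?_
      have h1 : p⁻¹ ≤ 1 := inv_le_one_of_one_le₀ hp.le
      have h2 : 0 ≤ (j : ℝ) / d := by positivity
      linarith
    obtain ⟨C, hC, h⟩ := weightedNorm_le_weightedSobolevNormOne hd (δ := δ + k) hone
      (inv_pos.2 (hpos (j + 1) hj)) (by
        push_cast
        rw [inv_inv, inv_inv]
        ring)
    refine ⟨C * (C₀ + d * C₁), by finiteness, fun f hf hfc l hl => ?_⟩
    refine (h _ (hf.pdList l) (hfc.pdList l)).trans ?_
    rw [mul_assoc]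
    gcongr
    exact weightedSobolevNormOne_pdList_le h₀ h₁ hf hfc hl

lemma weightedSobolevNorm_eq_ofReal {m : ℕ} {p δ : ℝ} (hp : 0 < p)
    {f : EuclideanSpace ℝ (Fin d) → ℝ} (hf : ContDiff ℝ (⊤ : ℕ∞) f) (hfc : HasCompactSupport f) :
    weightedSobolevNorm m p δ f = ENNReal.ofReal (∑ α ∈ mIdx d m,
      (∫ x, (jb x ^ (δ - d / p + msize α) * |mD α f x|) ^ p) ^ (1 / p)) := by
  rw [ENNReal.ofReal_sum_of_nonneg]
  · refine Finset.sum_congr rfl fun α _ => ?_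
    rw [weightedNorm_eq_integral hp (f := mD α f) (hf.pdList _).continuous (hfc.pdList _),
      add_sub_right_comm]
  · refine fun α _ => Real.rpow_nonneg (integral_nonneg fun x => ?_) _
    have := jb_pos x
    positivity

lemma exists_weightedNorm_le_weightedSobolevNorm {m : ℕ} (hd : 1 ≤ d) {p q δ : ℝ} (hp : 1 < p)
    (hcase : ((m : ℝ) * p < d ∧ p ≤ q ∧ q ≤ d * p / (d - m * p)) ∨
             ((m : ℝ) * p = d ∧ p ≤ q)) :
    ∃ s, q ≤ s ∧ ∃ C : ℝ≥0∞, C ≠ ∞ ∧ ∀ f : EuclideanSpace ℝ (Fin d) → ℝ,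
      ContDiff ℝ (⊤ : ℕ∞) f → HasCompactSupport f →
      weightedNorm s δ f ≤ C * weightedSobolevNorm m p δ f := by
  have hp0 : 0 < p := one_pos.trans hp
  have hd0 : (0 : ℝ) < d := by positivity
  rcases hcase with ⟨hm, -, hq⟩ | ⟨hm, -⟩
  · obtain ⟨C, hC, h⟩ := weightedNorm_pdList_le (m := m) hd hp δ m hm 0 (by simp)
    refine ⟨_, hq.trans_eq ?_, C, hC, fun f hf hfc => by simpa [pdList] using h f hf hfc [] rfl⟩
    have := (sub_pos.2 hm).ne'
    field_simp
  · obtain ⟨j, rfl⟩ : ∃ j, m = j + 1 := Nat.exists_eq_succ_of_ne_zero (by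
      rintro rfl
      rw [Nat.cast_zero, zero_mul] at hm
      exact hd0.ne hm)
    have hj : j * p < d := by
      push_cast at hm
      linarith
    have hd2 : 2 ≤ d := by
      by_contra! hlt
      have : d = 1 := by omega
      subst this
      push_cast at hm
      nlinarith [(Nat.cast_nonneg j : (0 : ℝ) ≤ j)]
    have hexp : (p⁻¹ - j / d : ℝ)⁻¹ = d := by
      rw [← hm]
      field_simp
      push_cast
      field_simp
      ring
    obtain ⟨C₀, hC₀, h₀⟩ := weightedNorm_pdList_le (m := j + 1) hd hp δ j hj 0 (by simp)
    obtain ⟨C₁, hC₁, h₁⟩ := weightedNorm_pdList_le (m := j + 1) hd hp δ j hj 1 (by omega)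
    rw [hexp] at h₀ h₁
    obtain ⟨s, hs, C, hC, h⟩ := exists_weightedNorm_le_weightedSobolevNormOne_dim hd2 q δ
    refine ⟨s, hs, C * (C₀ + d * C₁), by finiteness, fun f hf hfc => (h f hf hfc).trans ?_⟩
    rw [mul_assoc]
    gcongr
    simpa [pdList] using weightedSobolevNormOne_pdList_le (k := 0) h₀ h₁ hf hfc (l := []) rfl

end WeightedNorm

/-- Weighted Sobolev inequality for the spaces `W^{m,p}_δ(ℝ^d)`:
if `mp < d` and `p ≤ q ≤ dp/(d-mp)`, or `mp = d` and `p ≤ q < ∞`, then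
`‖f‖_{L^q_{δ-d/q}} ≤ C ‖f‖_{W^{m,p}_{δ-d/p}}` for all `f ∈ C_c^∞(ℝ^d)`. -/
theorem weighted_W_sobolev_inequality
    (d m : ℕ) (hd : 1 ≤ d) (p q δ : ℝ) (hp : 1 < p)
    (hcase : ((m : ℝ) * p < d ∧ p ≤ q ∧ q ≤ d * p / (d - m * p)) ∨
             ((m : ℝ) * p = d ∧ p ≤ q)) :
    ∃ C : ℝ, 0 < C ∧ ∀ f : EuclideanSpace ℝ (Fin d) → ℝ,
      ContDiff ℝ (⊤ : ℕ∞) f → HasCompactSupport f →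
      (∫ x, (jb x ^ (δ - (d : ℝ) / q) * |f x|) ^ q) ^ (1 / q) ≤
        C * ∑ α ∈ mIdx d m,
          (∫ x, (jb x ^ (δ - (d : ℝ) / p + (msize α : ℝ)) * |mD α f x|) ^ p) ^ (1 / p) := by
  have hp0 : 0 < p := one_pos.trans hp
  have hpq : p ≤ q := hcase.elim (fun h => h.2.1) fun h => h.2
  have hq0 : 0 < q := hp0.trans_le hpq
  obtain ⟨s, hqs, C, hC, hs⟩ := exists_weightedNorm_le_weightedSobolevNorm (δ := δ) hd hp hcase
  set B : ℝ := max 1 C.toReal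
  have hB0 : 0 < B := lt_max_of_lt_left one_pos
  have hA : (0 : ℝ) < 2 ^ (1 / q) := by positivity
  refine ⟨2 ^ (1 / q) * B, mul_pos hA hB0, fun f hf hfc => ?_⟩
  rw [mul_assoc, ← div_le_iff₀' hA]
  refine le_of_forall_gt_imp_ge_of_dense fun K hK => ?_
  have hnorm := weightedSobolevNorm_eq_ofReal (m := m) (δ := δ) hp0 hf hfc
  set S : ℝ := ∑ α ∈ mIdx d m,
    (∫ x, (jb x ^ (δ - (d : ℝ) / p + (msize α : ℝ)) * |mD α f x|) ^ p) ^ (1 / p)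
  have hS0 : 0 ≤ S := by
    refine Finset.sum_nonneg fun α _ => Real.rpow_nonneg (integral_nonneg fun x => ?_) _
    have := jb_pos x
    positivity
  have hK0 : 0 < K := (mul_nonneg hB0.le hS0).trans_lt hK
  have hfp : weightedNorm p δ f ≤ ENNReal.ofReal K := by
    have hle : weightedNorm p δ f ≤ weightedSobolevNorm m p δ f := by
      simpa [pdList] using
        weightedNorm_pdList_le_weightedSobolevNorm p δ hf (l := []) (Nat.zero_le m)
    rw [hnorm] at hle
    refine hle.trans (ENNReal.ofReal_le_ofReal ?_)
    exact (le_mul_of_one_le_left hS0 (le_max_left _ _)).trans hK.le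
  have hfs : weightedNorm s δ f ≤ ENNReal.ofReal K := by
    refine (hs f hf hfc).trans ?_
    rw [hnorm, ← ENNReal.ofReal_toReal hC, ← ENNReal.ofReal_mul ENNReal.toReal_nonneg]
    refine ENNReal.ofReal_le_ofReal (le_trans ?_ hK.le)
    gcongr
    exact le_max_right _ _
  have hfq := weightedNorm_interpolation hp0 hpq hqs hf.continuous hK0 hfp hfs
  rw [weightedNorm_eq_integral hq0 hf.continuous hfc,
    ENNReal.ofReal_le_ofReal_iff (by positivity)] at hfq
  exact (div_le_iff₀' hA).2 hfq
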